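/- (Lemma of Appendix C.) Let (a₀,a₁,a₂) and (b₀,b₁,b₂) be orthonormal bases of ℝ³ and set A_i = a_i·σ and B_i = b_i·σ (2×2 complex matrices). Let ρ be a separable two-qubit density matrix, i.e. a 4×4 matrix of the form ρ = ∑_λ p_λ (ρ_A^λ ⊗ ρ_B^λ) where the sum is finite, p_λ ≥ 0, ∑_λ p_λ = 1, and each ρ_A^λ, ρ_B^λ is a 2×2 density matrix, with ⊗ the Kronecker product. Then |Re Tr((A₀⊗B₀ + A₁⊗B₁ + A₂⊗B₂) * ρ)| ≤ 1. -/

import Mathlib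

open Matrix ComplexOrder Kronecker

/-- The Pauli matrices. -/
noncomputable def pauli1 : Matrix (Fin 2) (Fin 2) ℂ := !![0, 1; 1, 0]
noncomputable def pauli2 : Matrix (Fin 2) (Fin 2) ℂ := !![0, -Complex.I; Complex.I, 0]
noncomputable def pauli3 : Matrix (Fin 2) (Fin 2) ℂ := !![1, 0; 0, -1]

/-- `n·σ` for `n ∈ ℝ³`. -/
noncomputable def dotSigma (n : EuclideanSpace ℝ (Fin 3)) : Matrix (Fin 2) (Fin 2) ℂ :=
  (n 0 : ℂ) • pauli1 + (n 1 : ℂ) • pauli2 + (n 2 : ℂ) • pauli3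

/-- A density matrix: positive semidefinite with unit trace. -/
def IsDensityMatrix {d : Type*} [Fintype d] [DecidableEq d]
    (ρ : Matrix d d ℂ) : Prop :=
  ρ.PosSemidef ∧ ρ.trace = 1

/-- A separable two-qubit density matrix: a finite convex combination of Kronecker
products of qubit density matrices. -/
def IsSeparableTwoQubit (ρ : Matrix (Fin 2 × Fin 2) (Fin 2 × Fin 2) ℂ) : Prop :=
  ∃ (n : ℕ) (p : Fin n → ℝ) (ρA ρB : Fin n → Matrix (Fin 2) (Fin 2) ℂ),
    (∀ k, 0 ≤ p k) ∧ (∑ k, p k = 1) ∧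
    (∀ k, IsDensityMatrix (ρA k)) ∧ (∀ k, IsDensityMatrix (ρB k)) ∧
    ρ = ∑ k, (p k : ℂ) • (ρA k ⊗ₖ ρB k)

/-- The Bloch vector of a qubit operator. -/
noncomputable def blochVector (ρ : Matrix (Fin 2) (Fin 2) ℂ) : EuclideanSpace ℝ (Fin 3) :=
  !₂[2 * (ρ 0 1).re, -2 * (ρ 0 1).im, (ρ 0 0).re - (ρ 1 1).re]

lemma trace_dotSigma_mul {ρ : Matrix (Fin 2) (Fin 2) ℂ} (hρ : ρ.IsHermitian)
    (n : EuclideanSpace ℝ (Fin 3)) :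
    (dotSigma n * ρ).trace = (inner ℝ n (blochVector ρ) : ℝ) := by
  have h00 := hρ.apply 0 0
  have h11 := hρ.apply 1 1
  have h10 := hρ.apply 1 0
  simp only [Complex.ext_iff, Complex.star_def, Complex.conj_re, Complex.conj_im]
    at h00 h11 h10
  apply Complex.ext <;>
    simp [dotSigma, pauli1, pauli2, pauli3, blochVector, Matrix.trace_fin_two,
      Matrix.vecMul, dotProduct, Fin.sum_univ_two, Fin.sum_univ_three, PiLp.inner_apply,
      ← h10.1, ← h10.2]
  · ring
  · rw [show (ρ 0 0).im = 0 by linarith [h00.2], show (ρ 1 1).im = 0 by linarith [h11.2]]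
    ring

lemma IsDensityMatrix.norm_blochVector_le_one {ρ : Matrix (Fin 2) (Fin 2) ℂ}
    (hρ : IsDensityMatrix ρ) : ‖blochVector ρ‖ ≤ 1 := by
  obtain ⟨hpos, htr⟩ := hρ
  have hdet := (Complex.le_def.mp hpos.det_nonneg).1
  have h00 := hpos.isHermitian.apply 0 0
  have h10 := hpos.isHermitian.apply 1 0
  have h00' := congrArg Complex.im h00
  have htr' := congrArg Complex.re htr
  rw [← sq_le_one_iff₀ (norm_nonneg _), EuclideanSpace.real_norm_sq_eq]
  rw [Matrix.det_fin_two, ← h10] at hdet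
  simp [Matrix.trace_fin_two, blochVector, Fin.sum_univ_three] at *
  have : (ρ 0 0).im = 0 := by linarith
  rw [this] at hdet
  nlinarith [congrArg (· ^ 2) htr']

lemma Orthonormal.abs_sum_inner_mul_inner_le {ι E F : Type*} [Fintype ι]
    [NormedAddCommGroup E] [InnerProductSpace ℝ E] [NormedAddCommGroup F] [InnerProductSpace ℝ F]
    {a : ι → E} {b : ι → F} (ha : Orthonormal ℝ a) (hb : Orthonormal ℝ b) (x : E) (y : F) :
    |∑ i, inner ℝ (a i) x * inner ℝ (b i) y| ≤ ‖x‖ * ‖y‖ := by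
  have hx := ha.sum_inner_products_le x (s := Finset.univ)
  have hy := hb.sum_inner_products_le y (s := Finset.univ)
  simp only [Real.norm_eq_abs, sq_abs] at hx hy
  refine abs_le_of_sq_le_sq ?_ (by positivity)
  calc (∑ i, inner ℝ (a i) x * inner ℝ (b i) y) ^ 2
      ≤ (∑ i, inner ℝ (a i) x ^ 2) * ∑ i, inner ℝ (b i) y ^ 2 :=
        Finset.sum_mul_sq_le_sq_mul_sq _ _ _
    _ ≤ ‖x‖ ^ 2 * ‖y‖ ^ 2 := by gcongr
    _ = (‖x‖ * ‖y‖) ^ 2 := by ring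

lemma trace_sum_dotSigma_kronecker_mul {ι : Type*} [Fintype ι]
    (a b : ι → EuclideanSpace ℝ (Fin 3)) {ρ σ : Matrix (Fin 2) (Fin 2) ℂ}
    (hρ : ρ.IsHermitian) (hσ : σ.IsHermitian) :
    ((∑ i, dotSigma (a i) ⊗ₖ dotSigma (b i)) * (ρ ⊗ₖ σ)).trace =
      (∑ i, inner ℝ (a i) (blochVector ρ) * inner ℝ (b i) (blochVector σ) : ℝ) := by
  simp [Finset.sum_mul, Matrix.trace_sum, ← Matrix.mul_kronecker_mul, Matrix.trace_kronecker,
    trace_dotSigma_mul hρ, trace_dotSigma_mul hσ]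

/-- Lemma of Appendix C: for orthonormal bases `a, b` of `ℝ³`,
`A i = a i·σ`, `B i = b i·σ`, and any separable two-qubit density matrix `ρ`,
`|Re Tr((A₀⊗B₀ + A₁⊗B₁ + A₂⊗B₂) ρ)| ≤ 1`. -/
theorem persistency_stmt2
    (a b : Fin 3 → EuclideanSpace ℝ (Fin 3))
    (ha : Orthonormal ℝ a) (hb : Orthonormal ℝ b)
    (ρ : Matrix (Fin 2 × Fin 2) (Fin 2 × Fin 2) ℂ)
    (hρ : IsSeparableTwoQubit ρ) :
    |(((∑ i : Fin 3, dotSigma (a i) ⊗ₖ dotSigma (b i)) * ρ).trace.re)| ≤ 1 := by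
  obtain ⟨n, p, ρA, ρB, hp, hsum, hA, hB, rfl⟩ := hρ
  rw [Finset.mul_sum, Matrix.trace_sum, Complex.re_sum]
  calc _ ≤ ∑ k, |_| := Finset.abs_sum_le_sum_abs _ _
    _ ≤ ∑ k, p k := Finset.sum_le_sum fun k _ => ?_
    _ = 1 := hsum
  rw [Matrix.mul_smul, Matrix.trace_smul,
    trace_sum_dotSigma_kronecker_mul a b (hA k).1.isHermitian (hB k).1.isHermitian,
    smul_eq_mul, Complex.re_ofReal_mul, Complex.ofReal_re, abs_mul, abs_of_nonneg (hp k)]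
  refine mul_le_of_le_one_right (hp k) ((ha.abs_sum_inner_mul_inner_le hb _ _).trans ?_)
  exact mul_le_one₀ (hA k).norm_blochVector_le_one (norm_nonneg _)
    (hB k).norm_blochVector_le_one
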